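/- arXiv:math/0606463 — 2 statements merged into one kernel-verified Lean document; each statement's English description precedes it below -/
import Mathlib

section
/- Let W = S_d with d ≥ 1, N = dim_k W = C(n+d, d), ρ = (n+1)(d−1), and let a be an integer with 0 ≤ ρ − a < d. Let B : ⋀^N W ⊗_k (S_{ρ−a})^* → ⋀^{N−n−1} W ⊗_k S_a be the k-linear map defined on decomposables by B((g_1∧⋯∧g_N) ⊗ φ) = ∑_{I} ε(I) (⋀_{j∉I} g_j) ⊗ (φ⊗id)(Bez_{ρ−a,a}(g_{i_0},…,g_{i_n})), where the sum is over all (n+1)-element subsets I = {i_0 < ⋯ < i_n} of {1,…,N}, ε(I) is the sign of the shuffle moving I to the front, and Bez_{ρ−a,a}(g_{i_0},…,g_{i_n}) ∈ S_{ρ−a} ⊗_k S_a is the bidegree-(ρ−a, a) piece of the Bezoutian of g_{i_0},…,g_{i_n}. Then B is injective. -/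
open MvPolynomial TensorProduct

noncomputable section

/-- The "mixed" variable assignment: variables with index `< j` are sent to the
`y`-variables (the second summand), variables with index `≥ j` to the `x`-variables
(the first summand). -/
def mixv (k : Type*) [Field k] (n : ℕ) (j : ℕ) :
    Fin (n + 1) → MvPolynomial (Fin (n + 1) ⊕ Fin (n + 1)) k :=
  fun i => if (i : ℕ) < j then X (Sum.inr i) else X (Sum.inl i)

/-- `D` is the `j`-th divided difference `Δ_j(f)` of `f`. -/
def IsDivDiff (k : Type*) [Field k] (n : ℕ) (f : MvPolynomial (Fin (n + 1)) k)
    (j : Fin (n + 1)) (D : MvPolynomial (Fin (n + 1) ⊕ Fin (n + 1)) k) : Prop :=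
  D * (X (Sum.inl j) - X (Sum.inr j)) =
    aeval (mixv k n (j : ℕ)) f - aeval (mixv k n ((j : ℕ) + 1)) f

/-- Writing `Q ∈ k[x_0,…,x_n,y_0,…,y_n]` as `∑_α Q_α(x) y^α`, this is the coefficient
`Q_α(x) ∈ k[x_0,…,x_n]` of the monomial `y^α`. -/
def coeffY (k : Type*) [Field k] (n : ℕ) (Q : MvPolynomial (Fin (n + 1) ⊕ Fin (n + 1)) k)
    (α : Fin (n + 1) →₀ ℕ) : MvPolynomial (Fin (n + 1)) k :=
  MvPolynomial.coeff α ((sumAlgEquiv k (Fin (n + 1)) (Fin (n + 1))) (rename Sum.swap Q))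

/-- The `ℤ`-indexed graded piece `S_m ⊆ S = k[x_0,…,x_n]` (zero in negative degrees). -/
def gradedPiece (k : Type*) [Field k] (n : ℕ) (m : ℤ) :
    Submodule k (MvPolynomial (Fin (n + 1)) k) :=
  if 0 ≤ m then homogeneousSubmodule (Fin (n + 1)) k m.toNat else ⊥

lemma mem_gradedPiece_iff {k : Type*} [Field k] {n : ℕ} {m : ℤ} (hm : 0 ≤ m)
    (p : MvPolynomial (Fin (n + 1)) k) :
    p ∈ gradedPiece k n m ↔ p.IsHomogeneous m.toNat := by
  rw [gradedPiece, if_pos hm, mem_homogeneousSubmodule]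

lemma monomial_mem_gradedPiece {k : Type*} [Field k] {n : ℕ} {m : ℤ} (hm : 0 ≤ m)
    (α : Fin (n + 1) →₀ ℕ) (hα : α.degree = m.toNat) :
    monomial α (1 : k) ∈ gradedPiece k n m := by
  rw [mem_gradedPiece_iff hm]
  exact isHomogeneous_monomial _ hα

lemma span_monomials_gradedPiece {k : Type*} [Field k] {n : ℕ} {m : ℤ} (hm : 0 ≤ m) :
    (⊤ : Submodule k (gradedPiece k n m)) ≤ Submodule.span k
      (Set.range fun α : {α : Fin (n + 1) →₀ ℕ // α.degree = m.toNat} =>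
        (⟨monomial α.1 (1 : k), monomial_mem_gradedPiece hm α.1 α.2⟩ : gradedPiece k n m)) := by
  rintro ⟨p, hp⟩ -
  have hp' := (mem_gradedPiece_iff hm p).1 hp
  have hdeg : ∀ α ∈ p.support, α.degree = m.toNat := by
    intro α hα
    have := hp' (mem_support_iff.1 hα)
    rw [Finsupp.degree_eq_weight_one]
    exact this
  have : (⟨p, hp⟩ : gradedPiece k n m) = ∑ α ∈ p.support.attach,
      coeff α.1 p • (⟨monomial α.1 (1 : k),
        monomial_mem_gradedPiece hm α.1 (hdeg α.1 α.2)⟩ : gradedPiece k n m) := by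
    apply Subtype.ext
    rw [Submodule.coe_sum]
    simp only [Submodule.coe_smul, smul_monomial, smul_eq_mul, mul_one]
    rw [Finset.sum_attach p.support (fun α => monomial α (coeff α p))]
    exact (support_sum_monomial_coeff p).symm
  rw [this]
  refine Submodule.sum_mem _ fun α _ => Submodule.smul_mem _ _ (Submodule.subset_span ?_)
  exact ⟨⟨α.1, hdeg α.1 α.2⟩, rfl⟩

lemma linearIndependent_monomials_gradedPiece {k : Type*} [Field k] {n : ℕ} {m : ℤ}
    (hm : 0 ≤ m) :
    LinearIndependent k
      (fun α : {α : Fin (n + 1) →₀ ℕ // α.degree = m.toNat} =>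
        (⟨monomial α.1 (1 : k), monomial_mem_gradedPiece hm α.1 α.2⟩ : gradedPiece k n m)) := by
  apply LinearIndependent.of_comp (gradedPiece k n m).subtype
  have h := (basisMonomials (Fin (n + 1)) k).linearIndependent
  rw [coe_basisMonomials] at h
  exact h.comp (fun α : {α : Fin (n + 1) →₀ ℕ // α.degree = m.toNat} => α.1)
    Subtype.val_injective

lemma exists_good_basis (k : Type*) [Field k] (n d : ℕ) (hd : 1 ≤ d) :
    ∃ (h : n + 1 ≤ (n + d).choose d)
      (b : Module.Basis (Fin ((n + d).choose d)) k (gradedPiece k n d)),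
      ∀ i, ((b (Fin.castLE h i) : gradedPiece k n d) : MvPolynomial (Fin (n + 1)) k) = X i ^ d := by
  classical
  have hm : (0 : ℤ) ≤ (d : ℤ) := by positivity
  let T := {α : Fin (n + 1) →₀ ℕ // α.degree = ((d : ℤ)).toNat}
  let b₀ : Module.Basis T k (gradedPiece k n d) :=
    Module.Basis.mk (linearIndependent_monomials_gradedPiece hm) (span_monomials_gradedPiece hm)
  let e₁ : T ≃ (Finset.univ : Finset (Fin (n + 1))).finsuppAntidiag d :=
    Equiv.subtypeEquivRight (fun α => by
      simp [Finset.mem_finsuppAntidiag, Finsupp.degree_eq_sum])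
  have hcard : Fintype.card ((Finset.univ : Finset (Fin (n + 1))).finsuppAntidiag d) =
      (n + d).choose d := by
    rw [Fintype.card_coe, Finset.card_finsuppAntidiag_nat_eq_choose]
    congr 1
    simp
  let e : T ≃ Fin ((n + d).choose d) := e₁.trans (Fintype.equivFinOfCardEq hcard)
  let f : Fin (n + 1) → T := fun i => ⟨Finsupp.single i d, by simp⟩
  have hf : Function.Injective f := by
    intro i j hij
    have := Finsupp.single_left_injective (M := ℕ) (α := Fin (n + 1)) (b := d) (by omega)
    exact this (congrArg Subtype.val hij)
  have h : n + 1 ≤ (n + d).choose d := by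
    have := Fintype.card_le_of_injective _ (e.injective.comp hf)
    simpa using this
  obtain ⟨σ, hσ⟩ := Equiv.Perm.exists_extending_pair (e ∘ f) (Fin.castLE h)
    (e.injective.comp hf) (Fin.castLE_injective h)
  refine ⟨h, b₀.reindex (e.trans σ), fun i => ?_⟩
  have : (e.trans σ).symm (Fin.castLE h i) = f i := by
    rw [Equiv.symm_apply_eq]
    simp [← hσ]
  rw [Module.Basis.reindex_apply, this, Module.Basis.mk_apply]
  simp [f, X_pow_eq_monomial]

/-- The explicit Bezoutian matrix of `x_0^d, …, x_n^d`. -/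
def powMat (k : Type*) [Field k] (n d : ℕ) :
    Matrix (Fin (n + 1)) (Fin (n + 1)) (MvPolynomial (Fin (n + 1) ⊕ Fin (n + 1)) k) :=
  Matrix.diagonal fun i =>
    ∑ p ∈ Finset.range d, X (Sum.inl i) ^ p * X (Sum.inr i) ^ (d - 1 - p)

lemma powMat_isDivDiff (k : Type*) [Field k] (n d : ℕ) (r c : Fin (n + 1)) :
    IsDivDiff k n (X r ^ d) c (powMat k n d r c) := by
  unfold IsDivDiff powMat
  by_cases h : r = c
  · subst h
    rw [Matrix.diagonal_apply_eq, geom_sum₂_mul]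
    simp [mixv]
  · rw [Matrix.diagonal_apply_ne _ h]
    have h' : (r : ℕ) ≠ c := fun h' => h (Fin.ext h')
    have : (r : ℕ) < c ↔ (r : ℕ) < c + 1 := by omega
    simp [mixv, this]

lemma isDivDiff_unique {k : Type*} [Field k] {n : ℕ} {f : MvPolynomial (Fin (n + 1)) k}
    {j : Fin (n + 1)} {D D' : MvPolynomial (Fin (n + 1) ⊕ Fin (n + 1)) k}
    (h : IsDivDiff k n f j D) (h' : IsDivDiff k n f j D') : D = D' := by
  have hne : (X (Sum.inl j) - X (Sum.inr j) :
      MvPolynomial (Fin (n + 1) ⊕ Fin (n + 1)) k) ≠ 0 := by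
    rw [sub_ne_zero]
    intro h
    have := X_injective h
    simp at this
  exact mul_right_cancel₀ hne (h.trans h'.symm)

lemma coeffY_powMat (k : Type*) [Field k] (n d : ℕ) (β : Fin (n + 1) →₀ ℕ) :
    coeffY k n (powMat k n d).det β =
      ∑ p ∈ Fintype.piFinset (fun _ : Fin (n + 1) => Finset.range d),
        if (fun i => d - 1 - p i) = (β : Fin (n + 1) → ℕ) then
          monomial (Finsupp.equivFunOnFinite.symm p) (1 : k) else 0 := by
  classical
  unfold coeffY powMat
  rw [Matrix.det_diagonal, Finset.prod_univ_sum]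
  simp only [map_sum, map_prod, map_mul, map_pow, rename_X, Sum.swap_inl, Sum.swap_inr,
    sumAlgEquiv_X_inl, sumAlgEquiv_X_inr]
  rw [coeff_sum]
  refine Finset.sum_congr rfl fun p _ => ?_
  rw [Finset.prod_mul_distrib]
  simp only [← map_pow, ← map_prod]
  rw [coeff_C_mul, coeff_prod_X_pow, prod_X_pow]
  have h1 : (β = Finsupp.indicator Finset.univ fun i _ => d - 1 - p i) ↔
      (fun i => d - 1 - p i) = (β : Fin (n + 1) → ℕ) := by
    constructor
    · intro h; funext i; rw [h]; simp
    · intro h; ext i; rw [← h]; simp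
  have h2 : (Finsupp.indicator Finset.univ fun i _ => p i) = Finsupp.equivFunOnFinite.symm p := by
    ext i; simp
  simp only [h1, h2]
  split_ifs <;> simp

lemma coeffY_powMat_mem (k : Type*) [Field k] (n d : ℕ) (m : ℤ) (hm : 0 ≤ m)
    (β : Fin (n + 1) →₀ ℕ) (hβ : m + (∑ i, β i : ℕ) = (n + 1) * (d - 1 : ℤ)) :
    coeffY k n (powMat k n d).det β ∈ gradedPiece k n m := by
  rw [coeffY_powMat]
  refine Submodule.sum_mem _ fun p hp => ?_
  split_ifs with h
  · apply monomial_mem_gradedPiece hm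
    rw [Finsupp.degree_eq_sum]
    simp only [Finsupp.coe_equivFunOnFinite_symm]
    simp only [Fintype.mem_piFinset, Finset.mem_range] at hp
    have : ∑ i : Fin (n + 1), ((p i : ℤ) + β i) = (n + 1) * (d - 1 : ℤ) := by
      rw [Finset.sum_congr rfl (g := fun _ => (d - 1 : ℤ))]
      · simp; ring
      · intro i _
        have h1 := hp i
        have h2 := congrFun h i
        omega
    rw [Finset.sum_add_distrib] at this
    push_cast at hβ
    have h3 : ((∑ i, p i : ℕ) : ℤ) = m := by push_cast; linarith
    omega
  · exact Submodule.zero_mem _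

lemma coeffY_powMat_eq (k : Type*) [Field k] (n d : ℕ) (γ : Fin (n + 1) → ℕ)
    (hγ : ∀ i, γ i < d) :
    coeffY k n (powMat k n d).det (Finsupp.equivFunOnFinite.symm fun i => d - 1 - γ i) =
      monomial (Finsupp.equivFunOnFinite.symm γ) (1 : k) := by
  rw [coeffY_powMat, Finset.sum_eq_single γ]
  · simp
  · intro p hp hne
    rw [if_neg]
    intro h
    apply hne
    funext i
    have h1 := congrFun h i
    simp only [Fintype.mem_piFinset, Finset.mem_range] at hp
    simp only [Finsupp.coe_equivFunOnFinite_symm] at h1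
    have := hp i
    have := hγ i
    omega
  · intro h
    exact absurd (by simpa using hγ) h

/-- Let `W = S_d`, `N = dim W = C(n+d,d)`, `ρ = (n+1)(d−1)` and
`0 ≤ ρ − a < d`.  The Bezoutian contraction map
`B : ⋀^N W ⊗ (S_{ρ−a})^* → ⋀^{N−n−1} W ⊗ S_a`, defined on decomposables
`(g_1∧⋯∧g_N) ⊗ φ` as the signed sum over all `(n+1)`-element subsets `I` of the
complementary wedge tensored with `(φ ⊗ id)` applied to the bidegree-`(ρ−a,a)` part of
the Bezoutian of `g_I`, is injective. -/
theorem bezoutian_contraction_injective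
    (k : Type*) [Field k] (n : ℕ) (d : ℕ) (hd : 1 ≤ d) (a : ℤ)
    (ha₁ : 0 ≤ ((n + 1) * (d - 1) : ℤ) - a) (ha₂ : ((n + 1) * (d - 1) : ℤ) - a < d)
    (B : (↥(⋀[k]^((n + d).choose d) ↥(gradedPiece k n d)) ⊗[k]
            Module.Dual k ↥(gradedPiece k n (((n + 1) * (d - 1) : ℤ) - a))) →ₗ[k]
         (↥(⋀[k]^((n + d).choose d - n - 1) ↥(gradedPiece k n d)) ⊗[k]
            ↥(gradedPiece k n a)))
    (hB : ∀ (g : Fin ((n + d).choose d) → ↥(gradedPiece k n d))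
        (φ : Module.Dual k ↥(gradedPiece k n (((n + 1) * (d - 1) : ℤ) - a)))
        (w : ↥(⋀[k]^((n + d).choose d) ↥(gradedPiece k n d)))
        (_ : (w : ExteriorAlgebra k ↥(gradedPiece k n d)) =
              ExteriorAlgebra.ιMulti k ((n + d).choose d) g)
        (F : Finset (Fin ((n + d).choose d)) →
          ↥(⋀[k]^((n + d).choose d - n - 1) ↥(gradedPiece k n d)) ⊗[k] ↥(gradedPiece k n a)),
        (∀ (I : Finset (Fin ((n + d).choose d)))
            (hI : I.card = n + 1) (hc : Iᶜ.card = (n + d).choose d - n - 1)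
            (Dm : Matrix (Fin (n + 1)) (Fin (n + 1)) (MvPolynomial (Fin (n + 1) ⊕ Fin (n + 1)) k)),
            (∀ r c, IsDivDiff k n ((g (I.orderIsoOfFin hI r) : MvPolynomial (Fin (n + 1)) k))
              c (Dm r c)) →
            ∀ (wc : ↥(⋀[k]^((n + d).choose d - n - 1) ↥(gradedPiece k n d))),
              (wc : ExteriorAlgebra k ↥(gradedPiece k n d)) =
                ExteriorAlgebra.ιMulti k ((n + d).choose d - n - 1)
                  (fun t => g (Iᶜ.orderIsoOfFin hc t)) →
            ∀ (u : (Fin (n + 1) → ℕ) → ↥(gradedPiece k n (((n + 1) * (d - 1) : ℤ) - a)))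
              (v : (Fin (n + 1) → ℕ) → ↥(gradedPiece k n a)),
              (∀ β ∈ Finset.Nat.antidiagonalTuple (n + 1) a.toNat,
                ((u β : MvPolynomial (Fin (n + 1)) k) =
                    coeffY k n Dm.det (Finsupp.equivFunOnFinite.symm β)) ∧
                ((v β : MvPolynomial (Fin (n + 1)) k) =
                    monomial (Finsupp.equivFunOnFinite.symm β) (1 : k))) →
              F I = ((-1 : k) ^ ((∑ i ∈ I, (i : ℕ)) + n * (n + 1) / 2)) •
                (wc ⊗ₜ[k] ∑ β ∈ Finset.Nat.antidiagonalTuple (n + 1) a.toNat,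
                  φ (u β) • v β)) →
        B (w ⊗ₜ[k] φ) = ∑ I ∈ Finset.powersetCard (n + 1) Finset.univ, F I) :
    Function.Injective B := by
  classical
  obtain ⟨hN, b, hb⟩ := exists_good_basis k n d hd
  have ha₀ : 0 ≤ a := by
    by_contra hlt
    have h1 : (0 : ℤ) ≤ n * (d - 1) := mul_nonneg (by positivity) (by omega)
    nlinarith
  -- generalize the sizes
  revert B
  generalize (n + d).choose d = N at hN b hb ⊢
  generalize hm : ((n + 1) * (d - 1) : ℤ) - a = m at ha₁ ha₂ ⊢
  intro B hB
  have hcc : ∀ I : Finset (Fin N), I.card = n + 1 → Iᶜ.card = N - n - 1 := by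
    intro I hI
    rw [Finset.card_compl, Fintype.card_fin, hI]
    omega
  let ω : ⋀[k]^N (gradedPiece k n d) := exteriorPower.ιMulti k N b
  -- the key claim
  have key : ∀ φ : Module.Dual k (gradedPiece k n m), B (ω ⊗ₜ[k] φ) = 0 → φ = 0 := by
    intro φ hφ
    let Data : Finset (Fin N) →
        (↥(⋀[k]^(N - n - 1) ↥(gradedPiece k n d)) ⊗[k] ↥(gradedPiece k n a)) → Prop :=
      fun I z => ∃ (hI : I.card = n + 1) (hc : Iᶜ.card = N - n - 1)
        (Dm : Matrix (Fin (n + 1)) (Fin (n + 1)) (MvPolynomial (Fin (n + 1) ⊕ Fin (n + 1)) k))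
        (_ : ∀ r c, IsDivDiff k n ((b (I.orderIsoOfFin hI r) : MvPolynomial (Fin (n + 1)) k))
              c (Dm r c))
        (wc : ↥(⋀[k]^(N - n - 1) ↥(gradedPiece k n d)))
        (_ : (wc : ExteriorAlgebra k ↥(gradedPiece k n d)) =
                ExteriorAlgebra.ιMulti k (N - n - 1)
                  (fun t => b (Iᶜ.orderIsoOfFin hc t)))
        (u : (Fin (n + 1) → ℕ) → ↥(gradedPiece k n m))
        (v : (Fin (n + 1) → ℕ) → ↥(gradedPiece k n a))
        (_ : ∀ β ∈ Finset.Nat.antidiagonalTuple (n + 1) a.toNat,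
                ((u β : MvPolynomial (Fin (n + 1)) k) =
                    coeffY k n Dm.det (Finsupp.equivFunOnFinite.symm β)) ∧
                ((v β : MvPolynomial (Fin (n + 1)) k) =
                    monomial (Finsupp.equivFunOnFinite.symm β) (1 : k))),
        z = ((-1 : k) ^ ((∑ i ∈ I, (i : ℕ)) + n * (n + 1) / 2)) •
                (wc ⊗ₜ[k] ∑ β ∈ Finset.Nat.antidiagonalTuple (n + 1) a.toNat,
                  φ (u β) • v β)
    have huniq : ∀ I z z', Data I z → Data I z' → z = z' := by
      rintro I z z' ⟨hI, hc, Dm, hDm, wc, hwc, u, v, huv, rfl⟩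
        ⟨hI', hc', Dm', hDm', wc', hwc', u', v', huv', rfl⟩
      have e1 : Dm = Dm' := by
        ext1 r c
        exact isDivDiff_unique (hDm r c) (hDm' r c)
      subst e1
      have e2 : wc = wc' := Subtype.ext (hwc.trans hwc'.symm)
      subst e2
      congr 2
      refine Finset.sum_congr rfl fun β hβ => ?_
      rw [Subtype.ext ((huv β hβ).1.trans (huv' β hβ).1.symm),
        Subtype.ext ((huv β hβ).2.trans (huv' β hβ).2.symm)]
    let F : Finset (Fin N) →
        (↥(⋀[k]^(N - n - 1) ↥(gradedPiece k n d)) ⊗[k] ↥(gradedPiece k n a)) :=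
      fun I => if h : ∃ z, Data I z then h.choose else 0
    have hF : ∀ I z, Data I z → F I = z := by
      intro I z hz
      have h : ∃ z, Data I z := ⟨z, hz⟩
      have : F I = h.choose := dif_pos h
      rw [this]
      exact huniq I _ _ h.choose_spec hz
    have hsum := hB b φ ω rfl F (by
      intro I hI hc Dm hDm wc hwc u v huv
      exact hF I _ ⟨hI, hc, Dm, hDm, wc, hwc, u, v, huv, rfl⟩)
    rw [hφ] at hsum
    -- the distinguished subset
    let I₀ : Finset (Fin N) := Finset.univ.map (Fin.castLEEmb hN)
    have hI₀ : I₀.card = n + 1 := by simp [I₀]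
    have hord : ∀ r, ((I₀.orderIsoOfFin hI₀ r : I₀) : Fin N) = Fin.castLE hN r := by
      intro r
      have := Finset.orderEmbOfFin_unique hI₀ (f := Fin.castLE hN) (by intro x; simp [I₀])
        (Fin.strictMono_castLE hN)
      rw [this]
      rfl
    let s₀ : Set.powersetCard (Fin N) (N - n - 1) := ⟨I₀ᶜ, hcc I₀ hI₀⟩
    let L := exteriorPower.ιMultiDual k (N - n - 1) b s₀
    have hfam : ∀ (I : Finset (Fin N)) (hc : Iᶜ.card = N - n - 1)
        (wc : ↥(⋀[k]^(N - n - 1) ↥(gradedPiece k n d))),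
        (wc : ExteriorAlgebra k ↥(gradedPiece k n d)) =
                ExteriorAlgebra.ιMulti k (N - n - 1)
                  (fun t => b (Iᶜ.orderIsoOfFin hc t)) →
        wc = exteriorPower.ιMulti_family k (N - n - 1) b ⟨Iᶜ, hc⟩ := by
      intro I hc wc hwc
      apply Subtype.ext
      rw [hwc]
      rfl
    let P := (TensorProduct.lid k (gradedPiece k n a)).toLinearMap ∘ₗ
      LinearMap.rTensor (gradedPiece k n a) L
    have hP : ∀ I, I ≠ I₀ → P (F I) = 0 := by
      intro I hne
      by_cases h : ∃ z, Data I z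
      · obtain ⟨z, hz⟩ := h
        rw [hF I z hz]
        obtain ⟨hI, hc, Dm, hDm, wc, hwc, u, v, huv, rfl⟩ := hz
        rw [hfam I hc wc hwc]
        have : L (exteriorPower.ιMulti_family k (N - n - 1) b ⟨Iᶜ, hc⟩) = 0 := by
          apply exteriorPower.ιMultiDual_apply_nondiag
          intro h
          apply hne
          exact (compl_injective (congrArg Subtype.val h)).symm
        simp [P, this]
      · have : F I = 0 := dif_neg h
        rw [this, map_zero]
    have hP₀ : P (F I₀) = 0 := by
      have := congrArg P hsum
      rw [map_zero, map_sum, Finset.sum_eq_single I₀] at this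
      · exact this.symm
      · intro I _ hne
        exact hP I hne
      · intro h
        exact absurd (by simp [Finset.mem_powersetCard, hI₀]) h
    -- explicit data for the distinguished subset
    have hmemu : ∀ β ∈ Finset.Nat.antidiagonalTuple (n + 1) a.toNat,
        coeffY k n (powMat k n d).det (Finsupp.equivFunOnFinite.symm β) ∈ gradedPiece k n m := by
      intro β hβ
      apply coeffY_powMat_mem k n d m ha₁
      rw [Finset.Nat.mem_antidiagonalTuple] at hβ
      simp only [Finsupp.coe_equivFunOnFinite_symm]
      rw [hβ]
      omega
    have hmemv : ∀ β ∈ Finset.Nat.antidiagonalTuple (n + 1) a.toNat,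
        monomial (Finsupp.equivFunOnFinite.symm β) (1 : k) ∈ gradedPiece k n a := by
      intro β hβ
      apply monomial_mem_gradedPiece ha₀
      rw [Finset.Nat.mem_antidiagonalTuple] at hβ
      rw [Finsupp.degree_eq_sum]
      simpa using hβ
    let u : (Fin (n + 1) → ℕ) → ↥(gradedPiece k n m) := fun β =>
      if h : β ∈ Finset.Nat.antidiagonalTuple (n + 1) a.toNat then ⟨_, hmemu β h⟩ else 0
    let v : (Fin (n + 1) → ℕ) → ↥(gradedPiece k n a) := fun β =>
      if h : β ∈ Finset.Nat.antidiagonalTuple (n + 1) a.toNat then ⟨_, hmemv β h⟩ else 0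
    have hu : ∀ β (h : β ∈ Finset.Nat.antidiagonalTuple (n + 1) a.toNat),
        u β = ⟨_, hmemu β h⟩ := fun β h => dif_pos h
    have hv : ∀ β (h : β ∈ Finset.Nat.antidiagonalTuple (n + 1) a.toNat),
        v β = ⟨_, hmemv β h⟩ := fun β h => dif_pos h
    have hdata := hF I₀ _ ⟨hI₀, hcc I₀ hI₀, powMat k n d, by
        intro r c
        rw [hord, hb]
        exact powMat_isDivDiff k n d r c,
      exteriorPower.ιMulti k (N - n - 1) (fun t => b (I₀ᶜ.orderIsoOfFin (hcc I₀ hI₀) t)), rfl,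
      u, v, fun β hβ => ⟨by rw [hu β hβ], by rw [hv β hβ]⟩, rfl⟩
    rw [hdata, hfam I₀ (hcc I₀ hI₀) (exteriorPower.ιMulti k (N - n - 1)
      (fun t => b (I₀ᶜ.orderIsoOfFin (hcc I₀ hI₀) t))) rfl] at hP₀
    have hL : L (exteriorPower.ιMulti_family k (N - n - 1) b ⟨I₀ᶜ, hcc I₀ hI₀⟩) = 1 :=
      exteriorPower.ιMultiDual_apply_diag k (N - n - 1) b s₀
    have hsum0 : ∑ β ∈ Finset.Nat.antidiagonalTuple (n + 1) a.toNat, φ (u β) • v β = 0 := by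
      have h1 : ((-1 : k) ^ ((∑ i ∈ I₀, (i : ℕ)) + n * (n + 1) / 2)) •
          ∑ β ∈ Finset.Nat.antidiagonalTuple (n + 1) a.toNat, φ (u β) • v β = 0 := by
        rw [← hP₀, map_smul]
        simp only [P, LinearMap.comp_apply, LinearMap.rTensor_tmul, hL,
          LinearEquiv.coe_coe, TensorProduct.lid_tmul, one_smul]
      exact (smul_eq_zero.1 h1).resolve_left (pow_ne_zero _ (by simp))
    have hφu : ∀ β ∈ Finset.Nat.antidiagonalTuple (n + 1) a.toNat, φ (u β) = 0 := by
      intro β hβ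
      have h1 := congrArg (fun z : gradedPiece k n a =>
        coeff (Finsupp.equivFunOnFinite.symm β) (z : MvPolynomial (Fin (n + 1)) k)) hsum0
      simp only [Submodule.coe_sum, Submodule.coe_smul, coeff_sum, coeff_smul,
        Submodule.coe_zero, coeff_zero] at h1
      rw [Finset.sum_eq_single β] at h1
      · simpa [hv β hβ] using h1
      · intro β' hβ' hne
        rw [hv β' hβ']
        simp only [coeff_monomial]
        rw [if_neg (fun h => hne (Finsupp.equivFunOnFinite.symm.injective h)), smul_zero]
      · intro h
        exact absurd hβ h
    -- conclude on monomials
    refine LinearMap.ext_on (top_le_iff.1 (span_monomials_gradedPiece ha₁)) ?_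
    rintro _ ⟨⟨γ, hγ⟩, rfl⟩
    rw [Finsupp.degree_eq_sum] at hγ
    have hγlt : ∀ i, γ i < d := by
      intro i
      have : γ i ≤ ∑ j, γ j := Finset.single_le_sum (fun _ _ => Nat.zero_le _) (Finset.mem_univ i)
      omega
    have hβ : (fun i => d - 1 - γ i) ∈ Finset.Nat.antidiagonalTuple (n + 1) a.toNat := by
      rw [Finset.Nat.mem_antidiagonalTuple]
      have h1 : ∑ i : Fin (n + 1), (((d - 1 - γ i : ℕ) : ℤ) + γ i) = (n + 1) * (d - 1 : ℤ) := by
        rw [Finset.sum_congr rfl (g := fun _ => (d - 1 : ℤ))]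
        · simp; ring
        · intro i _
          have := hγlt i
          omega
      rw [Finset.sum_add_distrib] at h1
      have h2 : ((∑ i, γ i : ℕ) : ℤ) = m := by omega
      have h3 : ((∑ i : Fin (n + 1), (d - 1 - γ i) : ℕ) : ℤ) = a := by
        push_cast at h2 ⊢
        linarith
      omega
    have h1 := hφu _ hβ
    rw [hu _ hβ] at h1
    simp only [coeffY_powMat_eq k n d γ hγlt] at h1
    simpa using h1
  -- every element of the source is of the form `ω ⊗ φ`
  have hω : ∀ w : ⋀[k]^N (gradedPiece k n d), ∃ c : k, w = c • ω := by
    intro w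
    have hw : w ∈ Submodule.span k (Set.range (exteriorPower.ιMulti_family k N b)) := by
      rw [exteriorPower.ιMulti_family_span_of_span k b.span_eq]
      trivial
    have hr : Set.range (exteriorPower.ιMulti_family k N b) ⊆ {ω} := by
      rintro _ ⟨s, rfl⟩
      have hs : (s : Finset (Fin N)) = Finset.univ := by
        apply Finset.eq_univ_of_card
        rw [Fintype.card_fin]
        exact s.2
      have hid : ∀ t, Set.powersetCard.ofFinEmbEquiv.symm s t = t := by
        intro t
        have := Finset.orderEmbOfFin_unique (s := (s : Finset (Fin N))) (k := N) s.2 (f := id)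
          (by intro x; rw [hs]; exact Finset.mem_univ _) strictMono_id
        exact (congrFun this t).symm
      rw [Set.mem_singleton_iff, exteriorPower.ιMulti_family]
      congr 1
      funext t
      simp [hid]
    obtain ⟨c, hc⟩ := Submodule.mem_span_singleton.1 (Submodule.span_mono hr hw)
    exact ⟨c, hc.symm⟩
  have hform : ∀ x : (↥(⋀[k]^N ↥(gradedPiece k n d)) ⊗[k] Module.Dual k ↥(gradedPiece k n m)),
      ∃ φ, x = ω ⊗ₜ[k] φ := by
    intro x
    induction x using TensorProduct.induction_on with
    | zero => exact ⟨0, by simp⟩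
    | tmul w φ =>
      obtain ⟨c, rfl⟩ := hω w
      exact ⟨c • φ, by rw [TensorProduct.smul_tmul]⟩
    | add x y hx hy =>
      obtain ⟨φ, rfl⟩ := hx
      obtain ⟨ψ, rfl⟩ := hy
      exact ⟨φ + ψ, by rw [TensorProduct.tmul_add]⟩
  rw [injective_iff_map_eq_zero]
  intro x hx
  obtain ⟨φ, rfl⟩ := hform x
  rw [key φ hx, TensorProduct.tmul_zero]
end
end

section
/- Let f_0,…,f_n ∈ S_d (d ≥ 1) be homogeneous polynomials forming a regular sequence in S (equivalently, having no common zero in projective n-space over an algebraic closure of k). Let I = (f_0,…,f_n), R = S/I with its induced grading, ρ = (n+1)(d−1), and write the Bezoutian of f_0,…,f_n as Δ = ∑_α Δ_α(x) y^α. Then for every integer a with 0 ≤ a ≤ ρ, the k-linear map (R_{ρ−a})^* → R_a sending φ to ∑_{|α|=a} φ([Δ_α])·[x^α] is an isomorphism, where [g] denotes the class of g ∈ S in R. -/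
open MvPolynomial

noncomputable section

/-- The degree-`m` graded piece `R_m` of `R = S/I`, i.e. the image of `S_m`. -/
def quotPiece (k : Type*) [Field k] (n : ℕ) (I : Ideal (MvPolynomial (Fin (n + 1)) k))
    (m : ℕ) : Submodule k (MvPolynomial (Fin (n + 1)) k ⧸ I) :=
  (homogeneousSubmodule (Fin (n + 1)) k m).map (Ideal.Quotient.mkₐ k I).toLinearMap

theorem supportDim_weak {R : Type*} [CommRing R] (rs : List R) :
    ∀ (M : Type _) [AddCommGroup M] [Module R M] [Module.Finite R M],
    RingTheory.Sequence.IsWeaklyRegular M rs →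
    Module.supportDim R (M ⧸ Ideal.ofList rs • (⊤ : Submodule R M)) + rs.length ≤
      Module.supportDim R M := by
  induction rs with
  | nil =>
    intro M _ _ _ _
    rw [Ideal.ofList_nil, Submodule.bot_smul]
    simpa using (Module.supportDim_eq_of_equiv (Submodule.quotEquivOfEqBot (⊥ : Submodule R M) rfl)).le
  | cons x rs' ih =>
    intro M _ _ _ reg
    obtain ⟨h1, h2⟩ := (RingTheory.Sequence.isWeaklyRegular_cons_iff M _ _).mp reg
    have h3 := ih _ h2
    have h4 := Module.supportDim_quotSMulTop_succ_le_of_notMem_minimalPrimes (R := R) (M := M) (x := x)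
      (fun _ => h1.notMem_of_mem_minimalPrimes)
    rw [Module.supportDim_eq_of_equiv (Submodule.quotOfListConsSMulTopEquivQuotSMulTopInner M x _)]
    refine le_trans ?_ h4
    simp only [List.length_cons, Nat.cast_add, Nat.cast_one, ← add_assoc]
    gcongr

attribute [local instance] MvPolynomial.gradedAlgebra

theorem span_homog {k : Type*} [Field k] {n d : ℕ}
    (f : Fin (n + 1) → MvPolynomial (Fin (n + 1)) k)
    (hf : ∀ i, (f i).IsHomogeneous d) :
    (Ideal.span (Set.range f)).IsHomogeneous (homogeneousSubmodule (Fin (n + 1)) k) := by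
  apply Ideal.homogeneous_span
  rintro _ ⟨i, rfl⟩
  exact ⟨d, hf i⟩

theorem X_mem_radical {k : Type*} [Field k] {n d : ℕ}
    (f : Fin (n + 1) → MvPolynomial (Fin (n + 1)) k)
    (hf : ∀ i, (f i).IsHomogeneous d)
    (hreg : RingTheory.Sequence.IsRegular (MvPolynomial (Fin (n + 1)) k) (List.ofFn f))
    (i : Fin (n + 1)) : X i ∈ (Ideal.span (Set.range f)).radical := by
  set I := Ideal.span (Set.range f) with hI
  have hIl : Ideal.ofList (List.ofFn f) = I := by
    rw [hI, Ideal.ofList]; congr 1; ext; simp [-List.ofFn_succ, List.mem_ofFn]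
  have h1 := supportDim_weak (List.ofFn f) (MvPolynomial (Fin (n + 1)) k) hreg.toIsWeaklyRegular
  have h2 : ringKrullDim (MvPolynomial (Fin (n + 1)) k ⧸ I) + (n + 1 : ℕ) ≤ (n + 1 : ℕ) := by
    have e : Ideal.ofList (List.ofFn f) • (⊤ : Ideal (MvPolynomial (Fin (n + 1)) k)) = I := by
      rw [hIl]; simp
    rw [← Module.supportDim_quotient_eq_ringKrullDim, ← e]
    rw [Module.supportDim_self_eq_ringKrullDim, MvPolynomial.ringKrullDim_of_isNoetherianRing,
      ringKrullDim_eq_zero_of_field] at h1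
    simpa using h1
  have h3 : Ring.KrullDimLE 0 (MvPolynomial (Fin (n + 1)) k ⧸ I) := by
    rw [Ring.krullDimLE_iff]
    generalize ringKrullDim (MvPolynomial (Fin (n + 1)) k ⧸ I) = r at h2 ⊢
    induction r using WithBot.recBotCoe with
    | bot => exact bot_le
    | coe r =>
      induction r using ENat.recTopCoe with
      | top => exact absurd h2 (by
          intro h
          have : ((⊤ + ((n + 1 : ℕ) : ℕ∞) : ℕ∞) : WithBot ℕ∞) ≤ (((n + 1 : ℕ) : ℕ∞) : WithBot ℕ∞) := h
          rw [WithBot.coe_le_coe] at this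
          simp at this)
      | coe r =>
        have h' : r + (n + 1) ≤ n + 1 := by exact_mod_cast h2
        have : r = 0 := by omega
        subst this; simp
  rw [Ideal.radical_eq_sInf, Ideal.mem_sInf]
  rintro P ⟨hIP, hP⟩
  have hQ := hP.homogeneousCore (𝒜 := homogeneousSubmodule (Fin (n + 1)) k)
  have hQh := (P.homogeneousCore (homogeneousSubmodule (Fin (n + 1)) k)).isHomogeneous
  have hQP := P.toIdeal_homogeneousCore_le (homogeneousSubmodule (Fin (n + 1)) k)
  have hIQ : I ≤ (P.homogeneousCore (homogeneousSubmodule (Fin (n + 1)) k)).toIdeal := by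
    rw [hI, Ideal.span_le]
    rintro _ ⟨j, rfl⟩
    exact Ideal.mem_homogeneousCore_of_homogeneous_of_mem ⟨d, hf j⟩
      (hIP (Ideal.subset_span ⟨j, rfl⟩))
  generalize (P.homogeneousCore (homogeneousSubmodule (Fin (n + 1)) k)).toIdeal = Q at *
  apply hQP
  have hmax : Q.IsMaximal := by
    have : (Q.map (Ideal.Quotient.mk I)).IsPrime :=
      Ideal.map_isPrime_of_surjective Ideal.Quotient.mk_surjective (by simpa using hIQ)
    have hm : (Q.map (Ideal.Quotient.mk I)).IsMaximal := this.isMaximal'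
    have := Ideal.comap_isMaximal_of_surjective (Ideal.Quotient.mk I) Ideal.Quotient.mk_surjective
      (K := Q.map (Ideal.Quotient.mk I))
    rwa [Ideal.comap_map_of_surjective _ Ideal.Quotient.mk_surjective, ← RingHom.ker_eq_comap_bot,
      Ideal.mk_ker, sup_eq_left.mpr hIQ] at this
  have hle : Q ≤ RingHom.ker (constantCoeff (σ := Fin (n + 1)) (R := k)) := by
    intro p hp
    have h0 := homogeneousComponent_mem_of_mem hQh hp 0
    rw [homogeneousComponent_zero] at h0
    by_contra hne
    apply hQ.ne_top
    refine Ideal.eq_top_of_isUnit_mem _ h0 ?_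
    exact (IsUnit.mk0 _ (by simpa [RingHom.mem_ker, constantCoeff_eq] using hne)).map C
  rw [hmax.eq_of_le (RingHom.ker_ne_top _) hle]
  simp [RingHom.mem_ker]

/-- the monomial ideal lemma -/
theorem mem_of_X_mul {k : Type*} [Field k] {m : ℕ} (N : ℕ) (i : Fin m)
    (p : MvPolynomial (Fin m) k)
    (h : p * X i ∈ Ideal.span ((fun s => monomial s (1 : k)) ''
      {s | ∃ l, l ≠ i ∧ s = Finsupp.single l N})) :
    p ∈ Ideal.span ((fun s => monomial s (1 : k)) ''
      {s | ∃ l, l ≠ i ∧ s = Finsupp.single l N}) := by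
  rw [mem_ideal_span_monomial_image] at h ⊢
  intro s hs
  obtain ⟨_, ⟨l, hl, rfl⟩, h2⟩ := h (s + Finsupp.single i 1) (by
    rw [mem_support_iff, coeff_mul_X]; exact mem_support_iff.mp hs)
  refine ⟨_, ⟨l, hl, rfl⟩, ?_⟩
  rw [Finsupp.single_le_iff] at h2 ⊢
  simpa [Finsupp.single_apply, hl.symm] using h2

theorem det_update_mem {k : Type*} [Field k] {m : ℕ} (N : ℕ) (i : Fin m)
    (E : Matrix (Fin m) (Fin m) (MvPolynomial (Fin m) k))
    (hE : ∀ l, l ≠ i → ∑ j, E l j * X j = X l ^ N) (hi : ∑ j, E i j * X j = 0) :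
    E.det ∈ Ideal.span (Set.range fun l : Fin m => (X l : MvPolynomial (Fin m) k) ^ N) := by
  have hsub : Ideal.span ((fun s => monomial s (1 : k)) ''
      {s | ∃ l, l ≠ i ∧ s = Finsupp.single l N}) ≤
      Ideal.span (Set.range fun l : Fin m => (X l : MvPolynomial (Fin m) k) ^ N) := by
    apply Ideal.span_mono
    rintro _ ⟨_, ⟨l, _, rfl⟩, rfl⟩
    exact ⟨l, by simp [X_pow_eq_monomial]⟩
  apply hsub
  apply mem_of_X_mul
  have h1 : E.det * X i = ∑ l, E.adjugate i l * ∑ j, E l j * X j := by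
    have := congrFun (congrArg (fun M => M.mulVec (fun j => (X j : MvPolynomial (Fin m) k)))
      (Matrix.adjugate_mul E)) i
    simp only [← Matrix.mulVec_mulVec] at this
    simpa [Matrix.mulVec, dotProduct, Matrix.smul_apply, Matrix.one_apply] using this.symm
  rw [h1]
  refine Ideal.sum_mem _ fun l _ => Ideal.mul_mem_left _ _ ?_
  by_cases hl : l = i
  · rw [hl, hi]; exact zero_mem _
  · rw [hE l hl]
    exact Ideal.subset_span ⟨_, ⟨l, hl, rfl⟩, by simp [X_pow_eq_monomial]⟩

theorem det_sub_mem {k : Type*} [Field k] {m : ℕ} (N : ℕ)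
    (A B : Matrix (Fin m) (Fin m) (MvPolynomial (Fin m) k))
    (hA : ∀ l, ∑ j, A l j * X j = X l ^ N) (hB : ∀ l, ∑ j, B l j * X j = X l ^ N) :
    A.det - B.det ∈ Ideal.span (Set.range fun l : Fin m => (X l : MvPolynomial (Fin m) k) ^ N) := by
  classical
  suffices h : ∀ s : Finset (Fin m), A.det - (Matrix.of fun l => if l ∈ s then B l else A l).det ∈
      Ideal.span (Set.range fun l : Fin m => (X l : MvPolynomial (Fin m) k) ^ N) by
    have := h Finset.univ
    simpa using! this
  intro s
  induction s using Finset.induction_on with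
  | empty =>
    have : (Matrix.of fun l => if l ∈ (∅ : Finset (Fin m)) then B l else A l) = A := by
      ext; simp
    rw [this, sub_self]; exact zero_mem _
  | insert i s hi ih =>
    set M : Matrix (Fin m) (Fin m) (MvPolynomial (Fin m) k) :=
      Matrix.of fun l => if l ∈ s then B l else A l with hM
    have hMx : ∀ l, ∑ j, M l j * X j = X l ^ N := by
      intro l
      by_cases hl : l ∈ s
      · simpa [hM, hl] using hB l
      · simpa [hM, hl] using hA l
    have e1 : (Matrix.of fun l => if l ∈ insert i s then B l else A l) = M.updateRow i (B i) := by
      ext l j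
      by_cases hl : l = i
      · subst hl; simp
      · simp [hM, hl, Matrix.updateRow_ne]
    have e2 : M = M.updateRow i (M i) := by simp
    have e3 : M.det - (M.updateRow i (B i)).det = (M.updateRow i (M i - B i)).det := by
      have : M i = (M i - B i) + B i := by simp
      conv_lhs => rw [e2, this]
      rw [Matrix.det_updateRow_add]
      simp
    rw [e1]
    have e4 := det_update_mem N i (M.updateRow i (M i - B i))
      (fun l hl => by simpa [Matrix.updateRow_ne hl] using hMx l)
      (by simp [sub_mul, hMx i, hB i])
    rw [← e3] at e4
    have := add_mem ih e4
    simpa using this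

theorem det_notMem {k : Type*} [Field k] {m : ℕ}
    (f : Fin m → MvPolynomial (Fin m) k)
    (hrad : ∀ i, X i ∈ (Ideal.span (Set.range f)).radical)
    (A : Matrix (Fin m) (Fin m) (MvPolynomial (Fin m) k))
    (hA : ∀ i, f i = ∑ j, A i j * X j) : A.det ∉ Ideal.span (Set.range f) := by
  classical
  intro hdet
  choose e he using hrad
  set N := (∑ i, e i) + 1 with hN
  have hXN : ∀ i, (X i : MvPolynomial (Fin m) k) ^ N ∈ Ideal.span (Set.range f) := by
    intro i
    refine Ideal.pow_mem_of_pow_mem _ (he i) ?_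
    have := Finset.single_le_sum (f := e) (fun _ _ => Nat.zero_le _) (Finset.mem_univ i)
    omega
  have : ∀ i, ∃ c : Fin m → MvPolynomial (Fin m) k, ∑ j, c j * f j = X i ^ N := fun i => by
    simpa using (Ideal.mem_span_range_iff_exists_fun).mp (hXN i)
  choose B hB using this
  have h1 : ∀ l, ∑ j, (Matrix.of B * A) l j * X j = X l ^ N := by
    intro l
    rw [← hB l]
    simp only [Matrix.mul_apply, hA, Finset.sum_mul, Finset.mul_sum, Matrix.of_apply]
    rw [Finset.sum_comm]
    simp [mul_assoc]
  have h2 : ∀ l, ∑ j, (Matrix.diagonal fun l : Fin m => (X l : MvPolynomial (Fin m) k) ^ (N - 1)) l j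
      * X j = X l ^ N := by
    intro l
    simp [Matrix.diagonal_apply, ← pow_succ, hN]
  have h3 := det_sub_mem N _ _ h1 h2
  have h4 : (Matrix.of B * A).det ∈
      Ideal.span (Set.range fun l : Fin m => (X l : MvPolynomial (Fin m) k) ^ N) := by
    rw [Matrix.det_mul]
    obtain ⟨c, hc⟩ := (Ideal.mem_span_range_iff_exists_fun).mp hdet
    rw [← hc, Finset.mul_sum]
    refine Ideal.sum_mem _ fun i _ => ?_
    rw [mul_left_comm]
    apply Ideal.mul_mem_left
    have h5 : (Matrix.of B).det * f i = ∑ l, (Matrix.of B).adjugate i l * ∑ j, B l j * f j := by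
      have := congrFun (congrArg (fun M => M.mulVec f) (Matrix.adjugate_mul (Matrix.of B))) i
      simp only [← Matrix.mulVec_mulVec] at this
      simpa [Matrix.mulVec, dotProduct, Matrix.smul_apply, Matrix.one_apply] using this.symm
    rw [h5]
    refine Ideal.sum_mem _ fun l _ => Ideal.mul_mem_left _ _ ?_
    rw [hB l]
    exact Ideal.subset_span ⟨l, rfl⟩
  have h6 := sub_mem h4 h3
  rw [sub_sub_cancel, Matrix.det_diagonal] at h6
  have h7 : (∏ i : Fin m, (X i : MvPolynomial (Fin m) k) ^ (N - 1)) =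
      monomial (Finsupp.equivFunOnFinite.symm fun _ => N - 1) 1 := by
    rw [monomial_eq, Finsupp.prod_fintype _ _ (by simp)]
    simp
  have h8 : (Set.range fun l : Fin m => (X l : MvPolynomial (Fin m) k) ^ N) =
      (fun s => monomial s (1 : k)) '' (Set.range fun l => Finsupp.single l N) := by
    rw [← Set.range_comp]
    congr 1; ext1 l; simp [X_pow_eq_monomial]
  rw [h7, h8, mem_ideal_span_monomial_image] at h6
  obtain ⟨_, ⟨l, rfl⟩, h9⟩ := h6 _ (by
    rw [mem_support_iff, coeff_monomial, if_pos rfl]; exact one_ne_zero)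
  rw [Finsupp.single_le_iff] at h9
  simp at h9
  omega
/-- the algebra map identifying `k[x,y]` with `k[x][y]` -/
def toIter (k : Type*) [Field k] (n : ℕ) :
    MvPolynomial (Fin (n + 1) ⊕ Fin (n + 1)) k →ₐ[k]
      MvPolynomial (Fin (n + 1)) (MvPolynomial (Fin (n + 1)) k) :=
  (sumAlgEquiv k (Fin (n + 1)) (Fin (n + 1))).toAlgHom.comp (rename Sum.swap)

theorem toIter_inl {k : Type*} [Field k] {n : ℕ} (i : Fin (n + 1)) :
    toIter k n (X (Sum.inl i)) = C (X i) := by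
  simp [toIter]

theorem toIter_inr {k : Type*} [Field k] {n : ℕ} (i : Fin (n + 1)) :
    toIter k n (X (Sum.inr i)) = X i := by
  simp [toIter]

theorem toIter_C {k : Type*} [Field k] {n : ℕ} (a : k) :
    toIter k n (C a) = C (C a) := by
  simp [toIter]

theorem coeffY_eq {k : Type*} [Field k] {n : ℕ} (Q) (α) :
    coeffY k n Q α = coeff α (toIter k n Q) := by
  simp [toIter, coeffY]

theorem toIter_x {k : Type*} [Field k] {n : ℕ} (f : MvPolynomial (Fin (n + 1)) k) :
    toIter k n (aeval (mixv k n 0) f) = C f := by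
  induction f using MvPolynomial.induction_on with
  | C a => rw [algHom_C]; exact toIter_C a
  | add p q hp hq => simp only [map_add, hp, hq]
  | mul_X p i hp => rw [map_mul, map_mul, hp, aeval_X, mixv]; simp [toIter_inl]

theorem toIter_y {k : Type*} [Field k] {n : ℕ} (f : MvPolynomial (Fin (n + 1)) k) :
    toIter k n (aeval (mixv k n (n + 1)) f) = map C f := by
  induction f using MvPolynomial.induction_on with
  | C a => rw [algHom_C, map_C]; exact toIter_C a
  | add p q hp hq => simp only [map_add, hp, hq]
  | mul_X p i hp => rw [map_mul, map_mul, hp, aeval_X, mixv, if_pos i.isLt, toIter_inr, map_mul, map_X]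

theorem telescope {k : Type*} [Field k] {n : ℕ} (f : MvPolynomial (Fin (n + 1)) k)
    (D : Fin (n + 1) → MvPolynomial (Fin (n + 1) ⊕ Fin (n + 1)) k)
    (hD : ∀ j, IsDivDiff k n f j (D j)) :
    ∑ j, toIter k n (D j) * (C (X j) - X j) = C f - map C f := by
  rw [← toIter_x, ← toIter_y, ← map_sub, ← Finset.sum_range_sub' (fun j => aeval (mixv k n j) f),
    ← Fin.sum_univ_eq_sum_range (fun j => aeval (mixv k n j) f - aeval (mixv k n (j + 1)) f),
    map_sum]
  refine Finset.sum_congr rfl fun j _ => ?_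
  rw [← hD j, map_mul, map_sub, toIter_inl, toIter_inr]

/-- apply a functional to the coefficients -/
def theta {k : Type*} [Field k] {n : ℕ} (ψ : MvPolynomial (Fin (n + 1)) k →ₗ[k] k)
    (P : MvPolynomial (Fin (n + 1)) (MvPolynomial (Fin (n + 1)) k)) :
    MvPolynomial (Fin (n + 1)) k :=
  ∑ α ∈ P.support, monomial α (ψ (coeff α P))

theorem coeff_theta {k : Type*} [Field k] {n : ℕ} (ψ : MvPolynomial (Fin (n + 1)) k →ₗ[k] k)
    (P) (β) : coeff β (theta ψ P) = ψ (coeff β P) := by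
  classical
  rw [theta, coeff_sum]
  simp only [coeff_monomial, Finset.sum_ite_eq', mem_support_iff]
  by_cases h : coeff β P = 0 <;> simp [h]

theorem theta_add {k : Type*} [Field k] {n : ℕ} (ψ : MvPolynomial (Fin (n + 1)) k →ₗ[k] k)
    (P Q) : theta ψ (P + Q) = theta ψ P + theta ψ Q := by
  ext; simp [coeff_theta]

theorem theta_sub {k : Type*} [Field k] {n : ℕ} (ψ : MvPolynomial (Fin (n + 1)) k →ₗ[k] k)
    (P Q) : theta ψ (P - Q) = theta ψ P - theta ψ Q := by
  ext; simp [coeff_theta]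

theorem theta_sum {k : Type*} [Field k] {n : ℕ} (ψ : MvPolynomial (Fin (n + 1)) k →ₗ[k] k)
    {ι : Type*} (s : Finset ι) (P : ι → _) : theta ψ (∑ i ∈ s, P i) = ∑ i ∈ s, theta ψ (P i) := by
  ext; simp [coeff_theta, coeff_sum]

theorem theta_C_mul {k : Type*} [Field k] {n : ℕ} (ψ : MvPolynomial (Fin (n + 1)) k →ₗ[k] k)
    (g P) : theta ψ (C g * P) = theta (ψ ∘ₗ LinearMap.mulLeft k g) P := by
  ext; simp [coeff_theta]

theorem theta_map_mul {k : Type*} [Field k] {n : ℕ} (ψ : MvPolynomial (Fin (n + 1)) k →ₗ[k] k)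
    (h P) : theta ψ (map C h * P) = h * theta ψ P := by
  ext
  simp [coeff_theta, coeff_mul, coeff_map, ← smul_eq_C_mul]

theorem theta_linear {k : Type*} [Field k] {n : ℕ} 
    (f : Fin (n + 1) → MvPolynomial (Fin (n + 1)) k)
    (D : Matrix (Fin (n + 1)) (Fin (n + 1)) (MvPolynomial (Fin (n + 1) ⊕ Fin (n + 1)) k))
    (hD : ∀ i j, IsDivDiff k n (f i) j (D i j))
    (g : MvPolynomial (Fin (n + 1)) k) :
    ∀ (ψ : MvPolynomial (Fin (n + 1)) k →ₗ[k] k), (∀ p ∈ Ideal.span (Set.range f), ψ p = 0) →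
    theta (ψ ∘ₗ LinearMap.mulLeft k g) (toIter k n D.det) - g * theta ψ (toIter k n D.det) ∈
      Ideal.span (Set.range f) := by
  induction g using MvPolynomial.induction_on with
  | C a =>
    intro ψ _
    have : theta (ψ ∘ₗ LinearMap.mulLeft k (C a)) (toIter k n D.det) -
        C a * theta ψ (toIter k n D.det) = 0 := by
      rw [sub_eq_zero]
      ext
      simp [coeff_theta, ← smul_eq_C_mul]
    rw [this]
    exact zero_mem _
  | add p q hp hq =>
    intro ψ hψ
    convert! add_mem (hp ψ hψ) (hq ψ hψ) using 1
    rw [← theta_C_mul, ← theta_C_mul, ← theta_C_mul, C_add, add_mul, theta_add]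
    ring
  | mul_X p j hp =>
    intro ψ hψ
    have h1 := hp (ψ ∘ₗ LinearMap.mulLeft k (X j)) (fun q hq => hψ _ (Ideal.mul_mem_left _ _ hq))
    have h2 : theta (ψ ∘ₗ LinearMap.mulLeft k (X j)) (toIter k n D.det) -
        X j * theta ψ (toIter k n D.det) ∈ Ideal.span (Set.range f) := by
      rw [← theta_C_mul, ← theta_map_mul, ← theta_sub, map_X, ← sub_mul, mul_comm]
      have h3 : toIter k n D.det * (C (X j) - X j) =
          ∑ i, (C (f i) * ((toIter k n).mapMatrix D).adjugate j i -
            map C (f i) * ((toIter k n).mapMatrix D).adjugate j i) := by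
        rw [AlgHom.map_det]
        have := congrFun (congrArg (fun M => M.mulVec (fun j : Fin (n + 1) =>
          (C (X j) - X j : MvPolynomial (Fin (n + 1)) (MvPolynomial (Fin (n + 1)) k))))
          (Matrix.adjugate_mul ((toIter k n).mapMatrix D))) j
        simp only [← Matrix.mulVec_mulVec] at this
        have h4 : ((toIter k n).mapMatrix D).mulVec (fun j : Fin (n + 1) =>
          (C (X j) - X j : MvPolynomial (Fin (n + 1)) (MvPolynomial (Fin (n + 1)) k))) =
          fun i => C (f i) - map C (f i) := by
          ext1 i
          rw [← telescope (f i) (D i) (hD i)]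
          rfl
        rw [h4, Matrix.smul_mulVec, Matrix.one_mulVec] at this
        rw [Pi.smul_apply, smul_eq_mul] at this
        rw [← this]
        simp only [Matrix.mulVec, dotProduct]
        exact Finset.sum_congr rfl fun i _ => by ring
      rw [h3, theta_sum]
      refine Ideal.sum_mem _ fun i _ => ?_
      rw [theta_sub, theta_map_mul, theta_C_mul]
      have h5 : theta (ψ ∘ₗ LinearMap.mulLeft k (f i)) (((toIter k n).mapMatrix D).adjugate j i) = 0 := by
        ext β
        simpa [coeff_theta] using hψ _ (Ideal.mul_mem_right _ _ (Ideal.subset_span ⟨i, rfl⟩))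
      rw [h5, zero_sub]
      exact neg_mem (Ideal.mul_mem_right _ _ (Ideal.subset_span ⟨i, rfl⟩))
    convert! add_mem h1 (Ideal.mul_mem_left _ p h2) using 1
    rw [LinearMap.comp_assoc, ← LinearMap.mulLeft_mul, mul_comm p (X j)]
    ring

theorem homog_of_mul {k σ : Type*} [Field k] {d : ℕ} (P L : MvPolynomial σ k)
    (hL : L.IsHomogeneous 1) (hL0 : L ≠ 0) (h : (P * L).IsHomogeneous (d + 1)) :
    P.IsHomogeneous d := by
  classical
  have key : ∀ m, m ≠ d → homogeneousComponent m P = 0 := by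
    intro m hm
    have h1 := DirectSum.coe_decompose_mul_add_of_right_mem (homogeneousSubmodule σ k) (i := m)
      (a := P) (b := L) (j := 1) hL
    have h2 : homogeneousComponent (m + 1) (P * L) = homogeneousComponent m P * L := by
      rw [← decomposition.decompose'_apply, ← decomposition.decompose'_apply]
      exact h1
    rw [homogeneousComponent_of_mem h, if_neg (by omega)] at h2
    exact (mul_eq_zero.mp h2.symm).resolve_right hL0
  intro α hα
  by_contra hne
  have := congrArg (coeff α) (key α.degree (by rwa [Finsupp.degree_eq_weight_one]))
  rw [coeff_homogeneousComponent, if_pos rfl] at this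
  exact hα (by simpa using this)

theorem det_homog {k : Type*} [Field k] {n d : ℕ} (hd : 1 ≤ d)
    (f : Fin (n + 1) → MvPolynomial (Fin (n + 1)) k)
    (hf : ∀ i, (f i).IsHomogeneous d)
    (D : Matrix (Fin (n + 1)) (Fin (n + 1)) (MvPolynomial (Fin (n + 1) ⊕ Fin (n + 1)) k))
    (hD : ∀ i j, IsDivDiff k n (f i) j (D i j)) : D.det.IsHomogeneous ((n + 1) * (d - 1)) := by
  have hmix : ∀ i m, (aeval (mixv k n m) (f i)).IsHomogeneous d := by
    intro i m
    have := (hf i).aeval (mixv k n m) (n := 1) (fun j => by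
      rw [mixv]; split_ifs <;> exact isHomogeneous_X _ _)
    simpa using this
  have h1 : ∀ i j, (D i j).IsHomogeneous (d - 1) := by
    intro i j
    apply homog_of_mul (D i j) (X (Sum.inl j) - X (Sum.inr j))
    · exact (isHomogeneous_X _ _).sub (isHomogeneous_X _ _)
    · rw [sub_ne_zero]
      intro h
      have := X_injective h
      simp at this
    · rw [hD i j, Nat.sub_add_cancel hd]
      exact (hmix _ _).sub (hmix _ _)
  rw [Matrix.det_apply]
  refine IsHomogeneous.sum _ _ _ fun σ _ => ?_
  have h2 : (∏ i, D (σ i) i).IsHomogeneous ((n + 1) * (d - 1)) := by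
    have := IsHomogeneous.prod Finset.univ (fun i => D (σ i) i) (fun _ => d - 1) (fun i _ => h1 _ _)
    simpa using this
  rcases Int.units_eq_one_or (Equiv.Perm.sign σ) with h | h
  · simpa [h] using h2
  · simpa [h] using h2.neg

theorem toIter_monomial {k : Type*} [Field k] {n : ℕ} (s : Fin (n + 1) ⊕ Fin (n + 1) →₀ ℕ) (c : k) :
    toIter k n (monomial s c) =
      monomial (Finsupp.equivFunOnFinite.symm fun i => s (Sum.inr i))
        (monomial (Finsupp.equivFunOnFinite.symm fun i => s (Sum.inl i)) c) := by
  rw [monomial_eq, Finsupp.prod_fintype _ _ (by simp), Fintype.prod_sum_type]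
  conv_rhs => rw [monomial_eq, monomial_eq, Finsupp.prod_fintype _ _ (by simp),
    Finsupp.prod_fintype _ _ (by simp)]
  simp only [map_mul, map_prod, map_pow, toIter_inl, toIter_inr, toIter_C,
    Finsupp.equivFunOnFinite_symm_apply_apply]
  ring

theorem coeffY_homog {k : Type*} [Field k] {n r a b : ℕ} (hab : a + b = r) (Q)
    (hQ : IsHomogeneous Q r) (α : Fin (n + 1) →₀ ℕ) (hα : α.degree = a) :
    (coeffY k n Q α).IsHomogeneous b := by
  classical
  rw [coeffY_eq, Q.as_sum, map_sum, coeff_sum]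
  refine IsHomogeneous.sum _ _ _ fun s hs => ?_
  rw [toIter_monomial, coeff_monomial]
  split_ifs with h
  · apply isHomogeneous_monomial
    have h1 := hQ.degree_eq_sum_deg_support hs
    rw [← Finsupp.degree_apply] at h1
    have h2 : s.degree = (∑ i, s (Sum.inl i)) + ∑ i, s (Sum.inr i) := by
      rw [Finsupp.degree_eq_sum, Fintype.sum_sum_type]
    rw [← h, Finsupp.degree_eq_sum] at hα
    rw [Finsupp.degree_eq_sum]
    simp only [Finsupp.equivFunOnFinite_symm_apply_apply] at hα ⊢
    omega
  · exact isHomogeneous_zero _ _ _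

theorem mem_anti_iff {n a : ℕ} (β : Fin (n + 1) → ℕ) :
    β ∈ Finset.Nat.antidiagonalTuple (n + 1) a ↔
      (Finsupp.equivFunOnFinite.symm β).degree = a := by
  rw [Finset.Nat.mem_antidiagonalTuple, Finsupp.degree_eq_sum]
  simp

theorem coeff_zero_theta {k : Type*} [Field k] {n d : ℕ} (hd : 1 ≤ d)
    (f : Fin (n + 1) → MvPolynomial (Fin (n + 1)) k)
    (hf : ∀ i, (f i).IsHomogeneous d)
    (hreg : RingTheory.Sequence.IsRegular (MvPolynomial (Fin (n + 1)) k) (List.ofFn f))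
    (D : Matrix (Fin (n + 1)) (Fin (n + 1)) (MvPolynomial (Fin (n + 1) ⊕ Fin (n + 1)) k))
    (hD : ∀ i j, IsDivDiff k n (f i) j (D i j)) :
    map constantCoeff (toIter k n D.det) ∉ Ideal.span (Set.range f) := by
  have h1 : map constantCoeff (toIter k n D.det) =
      (Matrix.of fun i j => map constantCoeff (toIter k n (D i j))).det := by
    have := RingHom.map_det ((map (constantCoeff (σ := Fin (n + 1)) (R := k))
      (σ := Fin (n + 1))).comp (toIter k n).toRingHom) D
    exact this
  rw [h1]
  apply det_notMem f (X_mem_radical f hf hreg)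
  intro i
  have h2 := congrArg (map (constantCoeff (σ := Fin (n + 1)) (R := k)) (σ := Fin (n + 1)))
    (telescope (f i) (D i) (hD i))
  have h3 : constantCoeff (f i) = 0 := by
    rw [constantCoeff_eq]
    apply (hf i).coeff_eq_zero
    simp; omega
  have h4 : map constantCoeff (map (C : k →+* MvPolynomial (Fin (n + 1)) k) (f i)) = f i := by
    rw [map_map]
    have : (constantCoeff (σ := Fin (n + 1)) (R := k)).comp C = RingHom.id k := by
      ext; simp
    rw [this, map_id]
  simp only [map_sum, map_mul, map_sub, map_C, map_X, h3, h4, constantCoeff_X, C_0, zero_sub,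
    mul_neg, Finset.sum_neg_distrib, neg_inj] at h2
  exact h2.symm

theorem core {k : Type*} [Field k] {n d : ℕ} (hd : 1 ≤ d)
    (f : Fin (n + 1) → MvPolynomial (Fin (n + 1)) k)
    (hf : ∀ i, (f i).IsHomogeneous d)
    (hreg : RingTheory.Sequence.IsRegular (MvPolynomial (Fin (n + 1)) k) (List.ofFn f))
    (D : Matrix (Fin (n + 1)) (Fin (n + 1)) (MvPolynomial (Fin (n + 1) ⊕ Fin (n + 1)) k))
    (hD : ∀ i j, IsDivDiff k n (f i) j (D i j))
    (I : Ideal (MvPolynomial (Fin (n + 1)) k)) (hI : I = Ideal.span (Set.range f))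
    (a b : ℕ) (hab : a + b = (n + 1) * (d - 1))
    (φ : Module.Dual k (quotPiece k n I b))
    (u : (Fin (n + 1) → ℕ) → ↥(quotPiece k n I b))
    (v : (Fin (n + 1) → ℕ) → ↥(quotPiece k n I a))
    (huv : ∀ β ∈ Finset.Nat.antidiagonalTuple (n + 1) a,
          ((u β : MvPolynomial (Fin (n + 1)) k ⧸ I) =
              Ideal.Quotient.mk I
                (coeffY k n D.det (Finsupp.equivFunOnFinite.symm β)) ∧
            (v β : MvPolynomial (Fin (n + 1)) k ⧸ I) =
              Ideal.Quotient.mk I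
                (monomial (Finsupp.equivFunOnFinite.symm β) (1 : k))))
    (h0 : ∑ β ∈ Finset.Nat.antidiagonalTuple (n + 1) a, φ (u β) • v β = 0) : φ = 0 := by
  classical
  have hIh := span_homog f hf
  rw [← hI] at hIh
  have hdet := det_homog hd f hf D hD
  let π : MvPolynomial (Fin (n + 1)) k →ₗ[k] quotPiece k n I b :=
    LinearMap.codRestrict _ ((Ideal.Quotient.mkₐ k I).toLinearMap ∘ₗ homogeneousComponent b)
      (fun g => Submodule.mem_map_of_mem (homogeneousComponent_mem b g))
  have hπ : ∀ g, ((π g : quotPiece k n I b) : MvPolynomial (Fin (n + 1)) k ⧸ I) =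
    Ideal.Quotient.mk I (homogeneousComponent b g) := fun g => rfl
  let ψ : MvPolynomial (Fin (n + 1)) k →ₗ[k] k := φ ∘ₗ π
  have hψ : ∀ p ∈ I, ψ p = 0 := by
    intro p hp
    have : π p = 0 := by
      apply Subtype.ext
      rw [hπ]
      exact Ideal.Quotient.eq_zero_iff_mem.mpr (homogeneousComponent_mem_of_mem hIh hp b)
    simp [ψ, this]
  have hsum : theta ψ (toIter k n D.det) =
      ∑ β ∈ Finset.Nat.antidiagonalTuple (n + 1) a,
        φ (u β) • monomial (Finsupp.equivFunOnFinite.symm β) (1 : k) := by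
    ext γ
    rw [coeff_theta, coeff_sum]
    simp only [coeff_smul, coeff_monomial, Equiv.symm_apply_eq]
    simp only [smul_eq_mul, mul_ite, mul_one, mul_zero, Finset.sum_ite_eq']
    have hγ : γ = Finsupp.equivFunOnFinite.symm (Finsupp.equivFunOnFinite γ) := by simp
    split_ifs with h
    · have h1 := (huv _ h).1
      rw [← hγ] at h1
      have h2 : (coeffY k n D.det γ).IsHomogeneous b :=
        coeffY_homog hab _ hdet γ (by rw [mem_anti_iff, ← hγ] at h; exact h)
      rw [← coeffY_eq]
      change φ (π _) = _
      congr 1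
      apply Subtype.ext
      rw [h1, hπ, homogeneousComponent_eq_self h2]
    · rw [← coeffY_eq]
      rw [mem_anti_iff, ← hγ] at h
      change φ (π _) = _
      have : π (coeffY k n D.det γ) = 0 := by
        apply Subtype.ext
        rw [hπ]
        by_cases hle : γ.degree ≤ (n + 1) * (d - 1)
        · have h2 := coeffY_homog (Nat.add_sub_cancel' hle) _ hdet γ rfl
          rw [homogeneousComponent_of_mem h2, if_neg (by omega)]
          simp
        · have h2 : coeffY k n D.det γ = 0 := by
            have h3 := hdet
            by_contra hne
            rw [coeffY_eq] at hne
            apply hne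
            rw [D.det.as_sum, map_sum, coeff_sum]
            refine Finset.sum_eq_zero fun s hs => ?_
            rw [toIter_monomial, coeff_monomial, if_neg]
            rintro rfl
            apply hle
            rw [hdet.degree_eq_sum_deg_support hs, ← Finsupp.degree_apply]
            rw [Finsupp.degree_eq_sum, Finsupp.degree_eq_sum, Fintype.sum_sum_type]
            simp
          rw [h2]; simp
      rw [this]; simp
  have hmem : theta ψ (toIter k n D.det) ∈ I := by
    rw [← Ideal.Quotient.eq_zero_iff_mem, hsum, map_sum]
    have := congrArg (fun z : quotPiece k n I a => (z : MvPolynomial (Fin (n + 1)) k ⧸ I)) h0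
    simp only [Submodule.coe_sum, Submodule.coe_smul, ZeroMemClass.coe_zero] at this
    rw [← this]
    refine Finset.sum_congr rfl fun β hβ => ?_
    rw [(huv β hβ).2]
    exact map_smul (Ideal.Quotient.mkₐ k I) _ _
  by_contra hφ
  obtain ⟨⟨z, hz⟩, hne⟩ : ∃ z, φ z ≠ 0 := by
    by_contra! hall
    exact hφ (LinearMap.ext hall)
  obtain ⟨g, hg, rfl⟩ := hz
  have hlin := theta_linear f D hD g ψ (by rw [← hI]; exact hψ)
  rw [← hI] at hlin
  have hg' : g.IsHomogeneous b := hg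
  have h5 : ∀ h, ψ (g * h) = constantCoeff h * ψ g := by
    intro h
    have h1 := DirectSum.coe_decompose_mul_add_of_left_mem (homogeneousSubmodule (Fin (n + 1)) k)
      (i := b) (j := 0) (a := g) (b := h) hg
    have h2 : homogeneousComponent (b + 0) (g * h) = g * homogeneousComponent 0 h := by
      rw [← decomposition.decompose'_apply, ← decomposition.decompose'_apply]
      exact h1
    rw [add_zero, homogeneousComponent_zero] at h2
    have h3 : π (g * h) = constantCoeff h • π g := by
      apply Subtype.ext
      rw [hπ, h2, Submodule.coe_smul, hπ, homogeneousComponent_eq_self hg', mul_comm,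
        ← smul_eq_C_mul, constantCoeff_eq]
      exact map_smul (Ideal.Quotient.mkₐ k I) _ _
    simp [ψ, h3]
  have h6 : ψ g ≠ 0 := by
    have : π g = ⟨_, Submodule.mem_map_of_mem hg⟩ := by
      apply Subtype.ext
      rw [hπ, homogeneousComponent_eq_self hg']
      rfl
    change φ (π g) ≠ 0
    rw [this]; exact hne
  have h7 : theta (ψ ∘ₗ LinearMap.mulLeft k g) (toIter k n D.det) =
      C (ψ g) * map constantCoeff (toIter k n D.det) := by
    ext γ
    rw [coeff_theta, coeff_C_mul, coeff_map]
    rw [mul_comm]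
    exact h5 _
  have h8 : C (ψ g) * map constantCoeff (toIter k n D.det) ∈ I := by
    rw [← h7]
    have := add_mem hlin (Ideal.mul_mem_left _ g hmem)
    simpa using this
  apply coeff_zero_theta hd f hf hreg D hD
  rw [← hI]
  have h9 := Ideal.mul_mem_left _ (C (ψ g)⁻¹) h8
  rwa [← mul_assoc, ← C_mul, inv_mul_cancel₀ h6, C_1, one_mul] at h9

theorem exists_uv {k : Type*} [Field k] {n d : ℕ} (hd : 1 ≤ d)
    (f : Fin (n + 1) → MvPolynomial (Fin (n + 1)) k)
    (hf : ∀ i, (f i).IsHomogeneous d)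
    (D : Matrix (Fin (n + 1)) (Fin (n + 1)) (MvPolynomial (Fin (n + 1) ⊕ Fin (n + 1)) k))
    (hD : ∀ i j, IsDivDiff k n (f i) j (D i j))
    (a b : ℕ) (hab : a + b = (n + 1) * (d - 1)) :
    ∃ (u : (Fin (n + 1) → ℕ) → ↥(quotPiece k n (Ideal.span (Set.range f)) b))
      (v : (Fin (n + 1) → ℕ) → ↥(quotPiece k n (Ideal.span (Set.range f)) a)),
      ∀ β ∈ Finset.Nat.antidiagonalTuple (n + 1) a,
          ((u β : MvPolynomial (Fin (n + 1)) k ⧸ Ideal.span (Set.range f)) =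
              Ideal.Quotient.mk (Ideal.span (Set.range f))
                (coeffY k n D.det (Finsupp.equivFunOnFinite.symm β)) ∧
            (v β : MvPolynomial (Fin (n + 1)) k ⧸ Ideal.span (Set.range f)) =
              Ideal.Quotient.mk (Ideal.span (Set.range f))
                (monomial (Finsupp.equivFunOnFinite.symm β) (1 : k))) := by
  classical
  have h : ∀ β : Fin (n + 1) → ℕ,
      ∃ (u : ↥(quotPiece k n (Ideal.span (Set.range f)) b))
        (v : ↥(quotPiece k n (Ideal.span (Set.range f)) a)),
      β ∈ Finset.Nat.antidiagonalTuple (n + 1) a →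
          ((u : MvPolynomial (Fin (n + 1)) k ⧸ Ideal.span (Set.range f)) =
              Ideal.Quotient.mk (Ideal.span (Set.range f))
                (coeffY k n D.det (Finsupp.equivFunOnFinite.symm β)) ∧
            (v : MvPolynomial (Fin (n + 1)) k ⧸ Ideal.span (Set.range f)) =
              Ideal.Quotient.mk (Ideal.span (Set.range f))
                (monomial (Finsupp.equivFunOnFinite.symm β) (1 : k))) := by
    intro β
    by_cases hβ : β ∈ Finset.Nat.antidiagonalTuple (n + 1) a
    · have hβ' := (mem_anti_iff β).mp hβ
      exact ⟨⟨_, Submodule.mem_map_of_mem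
        ((mem_homogeneousSubmodule _ _).mpr (coeffY_homog hab _ (det_homog hd f hf D hD) _ hβ'))⟩,
        ⟨_, Submodule.mem_map_of_mem
        ((mem_homogeneousSubmodule _ _).mpr (isHomogeneous_monomial (1 : k) hβ'))⟩,
        fun _ => ⟨rfl, rfl⟩⟩
    · exact ⟨0, 0, fun h => absurd h hβ⟩
  choose u v huv using h
  exact ⟨u, v, huv⟩

theorem quotPiece_finite {k : Type*} [Field k] {n : ℕ} (I : Ideal (MvPolynomial (Fin (n + 1)) k))
    (m : ℕ) : Module.Finite k (quotPiece k n I m) := by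
  rw [Module.Finite.iff_fg]
  exact (homogeneousSubmodule_fg (R := k) (σ := Fin (n + 1)) m).map _

theorem finrank_le {k : Type*} [Field k] {n d : ℕ} (hd : 1 ≤ d)
    (f : Fin (n + 1) → MvPolynomial (Fin (n + 1)) k)
    (hf : ∀ i, (f i).IsHomogeneous d)
    (hreg : RingTheory.Sequence.IsRegular (MvPolynomial (Fin (n + 1)) k) (List.ofFn f))
    (D : Matrix (Fin (n + 1)) (Fin (n + 1)) (MvPolynomial (Fin (n + 1) ⊕ Fin (n + 1)) k))
    (hD : ∀ i j, IsDivDiff k n (f i) j (D i j))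
    (a b : ℕ) (hab : a + b = (n + 1) * (d - 1)) :
    Module.finrank k (quotPiece k n (Ideal.span (Set.range f)) b) ≤
      Module.finrank k (quotPiece k n (Ideal.span (Set.range f)) a) := by
  obtain ⟨u, v, huv⟩ := exists_uv hd f hf D hD a b hab
  have := quotPiece_finite (Ideal.span (Set.range f)) a
  have := quotPiece_finite (Ideal.span (Set.range f)) b
  let Ψ : Module.Dual k (quotPiece k n (Ideal.span (Set.range f)) b) →ₗ[k]
      quotPiece k n (Ideal.span (Set.range f)) a :=
    ∑ β ∈ Finset.Nat.antidiagonalTuple (n + 1) a, (Module.Dual.eval k _ (u β)).smulRight (v β)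
  have hΨ : Function.Injective Ψ := by
    rw [← LinearMap.ker_eq_bot, LinearMap.ker_eq_bot']
    intro φ hφ
    apply core hd f hf hreg D hD _ rfl a b hab φ u v huv
    rw [← hφ]
    simp [Ψ, LinearMap.sum_apply]
  have h := LinearMap.finrank_le_finrank_of_injective hΨ
  rwa [Subspace.dual_finrank_eq] at h

/-- For a regular sequence `f_0,…,f_n ∈ S_d` with Bezoutian
`Δ = ∑_α Δ_α(x) y^α`, `I = (f_0,…,f_n)`, `R = S/I`, `ρ = (n+1)(d−1)` and `0 ≤ a ≤ ρ`,
the `k`-linear map `(R_{ρ−a})^* → R_a`, `φ ↦ ∑_{|α|=a} φ([Δ_α])·[x^α]`, is an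
isomorphism. -/
theorem bezoutian_duality_complete_intersection
    (k : Type*) [Field k] (n : ℕ) (d : ℕ) (hd : 1 ≤ d)
    (f : Fin (n + 1) → MvPolynomial (Fin (n + 1)) k)
    (hf : ∀ i, (f i).IsHomogeneous d)
    (hreg : RingTheory.Sequence.IsRegular (MvPolynomial (Fin (n + 1)) k) (List.ofFn f))
    (D : Matrix (Fin (n + 1)) (Fin (n + 1)) (MvPolynomial (Fin (n + 1) ⊕ Fin (n + 1)) k))
    (hD : ∀ i j, IsDivDiff k n (f i) j (D i j))
    (a : ℕ) (ha : a ≤ (n + 1) * (d - 1))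
    (Φ : Module.Dual k
          ↥(quotPiece k n (Ideal.span (Set.range f)) ((n + 1) * (d - 1) - a)) →ₗ[k]
        ↥(quotPiece k n (Ideal.span (Set.range f)) a))
    (hΦ : ∀ (φ : Module.Dual k
          ↥(quotPiece k n (Ideal.span (Set.range f)) ((n + 1) * (d - 1) - a)))
        (u : (Fin (n + 1) → ℕ) →
          ↥(quotPiece k n (Ideal.span (Set.range f)) ((n + 1) * (d - 1) - a)))
        (v : (Fin (n + 1) → ℕ) → ↥(quotPiece k n (Ideal.span (Set.range f)) a)),
        (∀ β ∈ Finset.Nat.antidiagonalTuple (n + 1) a,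
          ((u β : MvPolynomial (Fin (n + 1)) k ⧸ Ideal.span (Set.range f)) =
              Ideal.Quotient.mk (Ideal.span (Set.range f))
                (coeffY k n D.det (Finsupp.equivFunOnFinite.symm β)) ∧
            (v β : MvPolynomial (Fin (n + 1)) k ⧸ Ideal.span (Set.range f)) =
              Ideal.Quotient.mk (Ideal.span (Set.range f))
                (monomial (Finsupp.equivFunOnFinite.symm β) (1 : k)))) →
        Φ φ = ∑ β ∈ Finset.Nat.antidiagonalTuple (n + 1) a, φ (u β) • v β) :
    Function.Bijective Φ := by
  have hab : a + ((n + 1) * (d - 1) - a) = (n + 1) * (d - 1) := by omega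
  have hfa := quotPiece_finite (Ideal.span (Set.range f)) a
  have hfb := quotPiece_finite (Ideal.span (Set.range f)) ((n + 1) * (d - 1) - a)
  obtain ⟨u, v, huv⟩ := exists_uv hd f hf D hD a _ hab
  have hinj : Function.Injective Φ := by
    rw [← LinearMap.ker_eq_bot, LinearMap.ker_eq_bot']
    intro φ hφ
    apply core hd f hf hreg D hD _ rfl a _ hab φ u v huv
    rw [← hΦ φ u v huv, hφ]
  have h1 := finrank_le hd f hf hreg D hD a _ hab
  have h2 := finrank_le hd f hf hreg D hD _ a ((add_comm _ _).trans hab)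
  refine ⟨hinj, (LinearMap.injective_iff_surjective_of_finrank_eq_finrank ?_).mp hinj⟩
  rw [Subspace.dual_finrank_eq]
  exact le_antisymm h1 h2
end
end
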